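/- With σ := S ⋆ P the convolution of the antipode with the projection onto the augmentation ideal, the generator Γ₃₃ has co-radical degree two: σ^{⋆2}(Γ₃₃) = Γ₃² ≠ 0, while σ^{⋆3}(Γ₃₃) = 0. -/

import Mathlib

/-!
The Hopf algebra `H = ℚ[Γ₃, Γ₄, Γ₃₃, Γ₄₄, Γ₄₃, Γ₃₄ₐ, Γ₃₄ᵦ]` of wheels in wheels.
Generators are indexed by `Fin 7` in the order Γ₃, Γ₄, Γ₃₃, Γ₄₄, Γ₄₃, Γ₃₄ₐ, Γ₃₄ᵦ.
-/

open TensorProduct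

noncomputable section WheelHopf

abbrev H : Type := MvPolynomial (Fin 7) ℚ

/-- The seven generators. -/
def Γ (i : Fin 7) : H := MvPolynomial.X i

/-- Images of the generators under the coproduct. -/
def ΔGen : Fin 7 → H ⊗[ℚ] H :=
  ![Γ 0 ⊗ₜ 1 + 1 ⊗ₜ Γ 0,
    Γ 1 ⊗ₜ 1 + 1 ⊗ₜ Γ 1,
    Γ 2 ⊗ₜ 1 + 1 ⊗ₜ Γ 2 + Γ 0 ⊗ₜ Γ 0,
    Γ 3 ⊗ₜ 1 + 1 ⊗ₜ Γ 3 + Γ 1 ⊗ₜ Γ 1,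
    Γ 4 ⊗ₜ 1 + 1 ⊗ₜ Γ 4 + Γ 1 ⊗ₜ Γ 0,
    Γ 5 ⊗ₜ 1 + 1 ⊗ₜ Γ 5 + Γ 0 ⊗ₜ Γ 1,
    Γ 6 ⊗ₜ 1 + 1 ⊗ₜ Γ 6 + Γ 0 ⊗ₜ Γ 1]

/-- The coproduct `Δ : H → H ⊗ H`, a `ℚ`-algebra homomorphism. -/
def Δ : H →ₐ[ℚ] H ⊗[ℚ] H := MvPolynomial.aeval ΔGen

/-- The counit `ε : H → ℚ`, sending every generator to `0`. -/
def ε : H →ₐ[ℚ] ℚ := MvPolynomial.aeval 0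

/-- The antipode `S : H → H`, a `ℚ`-algebra homomorphism. -/
def Santi : H →ₐ[ℚ] H := MvPolynomial.aeval
  ![-Γ 0, -Γ 1, -Γ 2 + Γ 0 ^ 2, -Γ 3 + Γ 1 ^ 2,
    -Γ 4 + Γ 1 * Γ 0, -Γ 5 + Γ 0 * Γ 1, -Γ 6 + Γ 0 * Γ 1]

/-- The projection `P = id − η∘ε` onto the augmentation ideal. -/
def Paug : H →ₗ[ℚ] H :=
  LinearMap.id - (Algebra.linearMap ℚ H) ∘ₗ ε.toLinearMap

/-- The convolution product `f ⋆ g = m ∘ (f ⊗ g) ∘ Δ` of linear maps `H → H`. -/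
def conv (f g : H →ₗ[ℚ] H) : H →ₗ[ℚ] H :=
  LinearMap.mul' ℚ H ∘ₗ TensorProduct.map f g ∘ₗ Δ.toLinearMap

/-- `σ = S ⋆ P`, the convolution of the antipode with the projection onto the
augmentation ideal. -/
def σconv : H →ₗ[ℚ] H := conv Santi.toLinearMap Paug

end WheelHopf


theorem conv_one (f g : H →ₗ[ℚ] H) : conv f g 1 = f 1 * g 1 := by
  simp [conv, Algebra.TensorProduct.one_def]

theorem conv_g0 (f g : H →ₗ[ℚ] H) : conv f g (Γ 0) = f (Γ 0) * g 1 + f 1 * g (Γ 0) := by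
  have h : Δ (Γ 0) = Γ 0 ⊗ₜ 1 + 1 ⊗ₜ Γ 0 := by
    simp [Δ, Γ, ΔGen]
  simp [conv, h]

theorem conv_g2 (f g : H →ₗ[ℚ] H) :
    conv f g (Γ 2) = f (Γ 2) * g 1 + f 1 * g (Γ 2) + f (Γ 0) * g (Γ 0) := by
  have h : Δ (Γ 2) = Γ 2 ⊗ₜ 1 + 1 ⊗ₜ Γ 2 + Γ 0 ⊗ₜ Γ 0 := by
    simp [Δ, Γ, ΔGen]
  simp [conv, h]

theorem Paug_one : Paug 1 = 0 := by simp [Paug]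

theorem Paug_gen (i : Fin 7) : Paug (Γ i) = Γ i := by simp [Paug, ε, Γ]

theorem sigma_one : σconv 1 = 0 := by simp [σconv, conv_one, Paug_one]

theorem sigma_g0 : σconv (Γ 0) = Γ 0 := by simp [σconv, conv_g0, Paug_one, Paug_gen]

/-- The generator `Γ₃₃` has co-radical degree two:
`σ^{⋆2}(Γ₃₃) = Γ₃² ≠ 0`, while `σ^{⋆3}(Γ₃₃) = 0`. -/
theorem Gamma33_coradical_degree_two :
    conv σconv σconv (Γ 2) = Γ 0 ^ 2
    ∧ (Γ 0 ^ 2 : H) ≠ 0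
    ∧ conv σconv (conv σconv σconv) (Γ 2) = 0 := by
  refine ⟨?_, ?_, ?_⟩
  · simp [conv_g2, sigma_one, sigma_g0, sq]
  · exact pow_ne_zero 2 (MvPolynomial.X_ne_zero 0)
  · simp [conv_g2, conv_g0, conv_one, sigma_one]
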